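/- Let H be a nonempty set, let I be a fine normal ideal on P_{ω1}(H), and let f : P_{ω1}(H) → Ordinals. Let H' ⊆ H be nonempty and let ⟨B_x : x ∈ H'⟩ be a family of members of I⁺ such that for every M ∈ P_{ω1}(H) there is at most one x ∈ M ∩ H' with M ∈ B_x. Let B := {M ∈ P_{ω1}(H) : ∃x ∈ M ∩ H', M ∈ B_x}. Let ⟨f_x : x ∈ H'⟩ be ordinal-valued functions on P_{ω1}(H) such that f_x ≤_{I+B_x} f for every x ∈ H'. Then B ∈ I⁺ and rk_{I+B}(f) ≥ min{rk_{I+B_x}(f_x) : x ∈ H'}. -/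

import Mathlib

namespace Galvin

/-- `P_{ω₁}(H)`: the collection of countable subsets of `H`. -/
def Pom (H : Type u) : Set (Set H) := {M : Set H | M.Countable}

/-- An ideal on `P_{ω₁}(H)`: a proper collection of subsets of `P_{ω₁}(H)` closed under
subsets and finite unions. -/
structure IsIdeal (H : Type u) (I : Set (Set (Set H))) : Prop where
  subset_pom : ∀ A ∈ I, A ⊆ Pom H
  empty_mem : (∅ : Set (Set H)) ∈ I
  subset_mem : ∀ A ∈ I, ∀ B : Set (Set H), B ⊆ A → B ∈ I
  union_mem : ∀ A ∈ I, ∀ B ∈ I, A ∪ B ∈ I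
  proper : Pom H ∉ I

/-- ℵ₁-completeness: closure under countable unions. -/
def IsComplete {H : Type u} (I : Set (Set (Set H))) : Prop :=
  ∀ A : ℕ → Set (Set H), (∀ n, A n ∈ I) → (⋃ n, A n) ∈ I

/-- A fine ideal: an ℵ₁-complete ideal containing `{M : x ∉ M}` for every `x ∈ H`. -/
def IsFineIdeal (H : Type u) (I : Set (Set (Set H))) : Prop :=
  IsIdeal H I ∧ IsComplete I ∧ ∀ x : H, {M ∈ Pom H | x ∉ M} ∈ I

/-- Normality: closure under diagonal unions. -/
def IsNormal (H : Type u) (I : Set (Set (Set H))) : Prop :=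
  ∀ A : H → Set (Set H), (∀ x, A x ∈ I) → {M ∈ Pom H | ∃ x ∈ M, M ∈ A x} ∈ I

/-- `I⁺`: the `I`-positive subsets of `P_{ω₁}(H)`. -/
def pos (H : Type u) (I : Set (Set (Set H))) : Set (Set (Set H)) :=
  {A | A ⊆ Pom H ∧ A ∉ I}

/-- `I*`: the dual filter of `I`. -/
def star (H : Type u) (I : Set (Set (Set H))) : Set (Set (Set H)) :=
  {A | Pom H \ A ∈ I}

/-- `I + A`: the ideal `{B : B ∩ A ∈ I}`. -/
def add (H : Type u) (I : Set (Set (Set H))) (A : Set (Set H)) : Set (Set (Set H)) :=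
  {B | B ⊆ Pom H ∧ B ∩ A ∈ I}

end Galvin
namespace Galvin

/-- `f <_I g`: `f` is less than `g` modulo the ideal `I`. -/
def ltIdeal (H : Type u) (I : Set (Set (Set H))) (f g : Set H → Ordinal.{v}) : Prop :=
  {M ∈ Pom H | ¬ f M < g M} ∈ I

/-- `f ≤_I g`: `f` is at most `g` modulo the ideal `I`. -/
def leIdeal (H : Type u) (I : Set (Set (Set H))) (f g : Set H → Ordinal.{v}) : Prop :=
  {M ∈ Pom H | ¬ f M ≤ g M} ∈ I

/-- `rk_I(f)`: the rank of `f` in the relation `<_I` (which is well-founded whenever `I` is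
ℵ₁-complete); junk value `0` in the degenerate non-well-founded case. -/
noncomputable def rk (H : Type u) (I : Set (Set (Set H))) (f : Set H → Ordinal.{v}) :
    Ordinal :=
  letI := Classical.dec (WellFounded (ltIdeal.{u, v} H I))
  if h : WellFounded (ltIdeal.{u, v} H I) then (h.apply f).rank else 0

end Galvin

namespace Galvin

/-- The relation `<_{I+A}` is well-founded when `I` is `ℵ₁`-complete and `A` is `I`-positive. -/
theorem wellFounded_ltIdeal_add {H : Type u} {I : Set (Set (Set H))} (hI : IsIdeal H I)
    (hc : IsComplete I) {A : Set (Set H)} (hA : A ∈ pos H I) :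
    WellFounded (ltIdeal.{u, v} H (add H I A)) := by
  rw [wellFounded_iff_isEmpty_descending_chain]
  refine ⟨fun ⟨s, hs⟩ => ?_⟩
  have hU := hc _ fun n => (hs n).2
  refine hA.2 (hI.subset_mem _ hU A fun M hM => ?_)
  by_contra hcon
  have hlt : ∀ n, s (n + 1) M < s n M := by
    intro n
    by_contra hn
    exact hcon (Set.mem_iUnion.2 ⟨n, ⟨hA.1 hM, hn⟩, hM⟩)
  exact (wellFounded_iff_isEmpty_descending_chain.1
    (wellFounded_lt : WellFounded ((· < ·) : Ordinal.{v} → Ordinal.{v} → Prop))).false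
      ⟨fun n => s n M, hlt⟩

theorem rk_lt_rk {H : Type u} {I : Set (Set (Set H))} (hw : WellFounded (ltIdeal.{u, v} H I))
    {h f : Set H → Ordinal.{v}} (hf : ltIdeal H I h f) : rk H I h < rk H I f := by
  simp only [rk, dif_pos hw]
  exact Acc.rank_lt_of_rel _ hf

theorem exists_ltIdeal_le_rk {H : Type u} {I : Set (Set (Set H))} {f : Set H → Ordinal.{v}}
    {b : Ordinal.{max u (v + 1)}} (hb : b < rk H I f) :
    ∃ h, ltIdeal H I h f ∧ b ≤ rk H I h := by
  by_cases hw : WellFounded (ltIdeal.{u, v} H I)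
  · simp only [rk, dif_pos hw] at hb ⊢
    rw [Acc.rank_eq, Ordinal.lt_iSup_iff] at hb
    obtain ⟨⟨h, hh⟩, hlt⟩ := hb
    exact ⟨h, hh, Order.lt_succ_iff.1 hlt⟩
  · simp only [rk, dif_neg hw] at hb
    exact absurd hb not_lt_zero

/-- The diagonal union of a nonempty family of positive sets is positive. -/
theorem diagonalUnion_mem_pos {H : Type u} {I : Set (Set (Set H))} (hI : IsFineIdeal H I)
    {H' : Set H} (hH' : H'.Nonempty) {B : H → Set (Set H)} (hB : ∀ x ∈ H', B x ∈ pos H I) :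
    {M ∈ Pom H | ∃ x ∈ M ∩ H', M ∈ B x} ∈ pos H I := by
  refine ⟨fun M hM => hM.1, fun hmem => ?_⟩
  obtain ⟨x, hx⟩ := hH'
  refine (hB x hx).2 (hI.1.subset_mem _ (hI.1.union_mem _ hmem _ (hI.2.2 x)) _ fun M hM => ?_)
  have hMP := (hB x hx).1 hM
  by_cases hxM : x ∈ M
  · exact Or.inl ⟨hMP, x, ⟨hxM, hx⟩, hM⟩
  · exact Or.inr ⟨hMP, hxM⟩

/-- Functions `h x` can be glued along a family `B` that is disjoint in the diagonal sense. -/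
theorem exists_glue {H : Type u} {H' : Set H} {B : H → Set (Set H)}
    (huniq : ∀ M ∈ Pom H, ∀ x ∈ M ∩ H', ∀ y ∈ M ∩ H', M ∈ B x → M ∈ B y → x = y)
    (h : H → Set H → Ordinal.{v}) :
    ∃ k : Set H → Ordinal.{v}, ∀ M ∈ Pom H, ∀ x ∈ M ∩ H', M ∈ B x → k M = h x M := by
  classical
  refine ⟨fun M => if hM : ∃ x ∈ M ∩ H', M ∈ B x then h hM.choose M else 0,
    fun M hM x hx hxB => ?_⟩
  have hex : ∃ x ∈ M ∩ H', M ∈ B x := ⟨x, hx, hxB⟩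
  have heq := huniq M hM _ hex.choose_spec.1 x hx hex.choose_spec.2 hxB
  simp only [dif_pos hex, heq]

theorem le_rk_diagonalUnion {H : Type u} {I : Set (Set (Set H))}
    (hI : IsFineIdeal H I) (hIn : IsNormal H I) {H' : Set H} (hH' : H'.Nonempty)
    {B : H → Set (Set H)} (hBpos : ∀ x ∈ H', B x ∈ pos H I)
    (huniq : ∀ M ∈ Pom H, ∀ x ∈ M ∩ H', ∀ y ∈ M ∩ H', M ∈ B x → M ∈ B y → x = y)
    (a : Ordinal.{max u (v + 1)}) (f : Set H → Ordinal.{v}) (g : H → Set H → Ordinal.{v})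
    (hg : ∀ x ∈ H', leIdeal H (add H I (B x)) (g x) f)
    (ha : ∀ x ∈ H', a ≤ rk H (add H I (B x)) (g x)) :
    a ≤ rk H (add H I {M ∈ Pom H | ∃ x ∈ M ∩ H', M ∈ B x}) f := by
  classical
  induction a using WellFoundedLT.induction generalizing f g with
  | _ a ih =>
    refine le_of_forall_lt fun b hb => ?_
    have hex : ∀ x, ∃ h, x ∈ H' →
        ltIdeal H (add H I (B x)) h (g x) ∧ b ≤ rk H (add H I (B x)) h := by
      intro x
      by_cases hx : x ∈ H'
      · obtain ⟨h, hh⟩ := exists_ltIdeal_le_rk (hb.trans_le (ha x hx))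
        exact ⟨h, fun _ => hh⟩
      · exact ⟨f, fun hx' => absurd hx' hx⟩
    choose h hh using hex
    obtain ⟨k, hk⟩ := exists_glue huniq h
    have hle : ∀ x ∈ H', leIdeal H (add H I (B x)) (h x) k := by
      refine fun x hx => ⟨fun M hM => hM.1, hI.1.subset_mem _ (hI.2.2 x) _ ?_⟩
      rintro M ⟨⟨hM, hnle⟩, hMB⟩
      exact ⟨hM, fun hxM => hnle (hk M hM x ⟨hxM, hx⟩ hMB).ge⟩
    have hlt : ltIdeal H (add H I {M ∈ Pom H | ∃ x ∈ M ∩ H', M ∈ B x}) k f := by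
      refine ⟨fun M hM => hM.1, ?_⟩
      have hbad := hIn (fun x => if x ∈ H' then
          {M ∈ Pom H | ¬ h x M < g x M} ∩ B x ∪ {M ∈ Pom H | ¬ g x M ≤ f M} ∩ B x else ∅) (by
        intro x
        split_ifs with hx
        · exact hI.1.union_mem _ (hh x hx).1.2 _ (hg x hx).2
        · exact hI.1.empty_mem)
      refine hI.1.subset_mem _ hbad _ ?_
      rintro M ⟨⟨hM, hnlt⟩, -, x, hx, hMB⟩
      refine ⟨hM, x, hx.1, ?_⟩
      rw [if_pos hx.2]
      rw [hk M hM x hx hMB] at hnlt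
      by_cases h1 : h x M < g x M
      · exact Or.inr ⟨⟨hM, fun h2 => hnlt (h1.trans_le h2)⟩, hMB⟩
      · exact Or.inl ⟨⟨hM, h1⟩, hMB⟩
    exact (ih b hb k h hle fun x hx => (hh x hx).2).trans_lt
      (rk_lt_rk (wellFounded_ltIdeal_add hI.1 hI.2.1 (diagonalUnion_mem_pos hI hH' hBpos)) hlt)

end Galvin

namespace Galvin

/-- The second claim in Lemma 3.7: for a fine normal ideal `I`, a family `⟨B_x : x ∈ H'⟩` of
`I`-positive sets such that each `M` lies in `B_x` for at most one `x ∈ M ∩ H'`, with diagonal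
union `B = {M : ∃ x ∈ M ∩ H', M ∈ B_x}`, and functions `f_x ≤_{I+B_x} f`, the set `B` is
`I`-positive and `rk_{I+B}(f) ≥ min_{x ∈ H'} rk_{I+B_x}(f_x)`. -/
theorem rank_diagonal_union_ge_min {H : Type u} [Nonempty H] (I : Set (Set (Set H)))
    (hI : IsFineIdeal H I) (hIn : IsNormal H I) (f : Set H → Ordinal.{v})
    (H' : Set H) (hH' : H'.Nonempty)
    (B : H → Set (Set H)) (hBpos : ∀ x ∈ H', B x ∈ pos H I)
    (huniq : ∀ M ∈ Pom H, ∀ x ∈ M ∩ H', ∀ y ∈ M ∩ H', M ∈ B x → M ∈ B y → x = y)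
    (g : H → Set H → Ordinal.{v})
    (hg : ∀ x ∈ H', leIdeal H (add H I (B x)) (g x) f) :
    {M ∈ Pom H | ∃ x ∈ M ∩ H', M ∈ B x} ∈ pos H I ∧
      ⨅ x : ↥H', rk H (add H I (B ↑x)) (g ↑x) ≤
        rk H (add H I {M ∈ Pom H | ∃ x ∈ M ∩ H', M ∈ B x}) f := by
  refine ⟨diagonalUnion_mem_pos hI hH' hBpos, ?_⟩
  exact le_rk_diagonalUnion hI hIn hH' hBpos huniq _ f g hg fun x hx =>
    ciInf_le' (fun x : ↥H' => rk H (add H I (B ↑x)) (g ↑x)) ⟨x, hx⟩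

end Galvin
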